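/- arXiv:cs/9912014 — 4 statements merged into one kernel-verified Lean document; each statement's English description precedes it below -/
import Mathlib

section
/- For every positive integer n, the set of triples (i,j,k) of natural numbers with i < k and (k+1)·2^j ≤ n is finite and its cardinality D satisfies 3·D ≤ 2·n². (Equivalently: the number of distances D(i,j,k) between distinct pairs of sets S(i,j), S(k,j) at the same level is at most 2n²/3.) -/
/-- The quadtree triples of size `n` are covered by those of level `0` together with the shifted
triples of size `n / 2`; hence a finite set of cardinality at most `2n²/3` contains all of them. -/
theorem exists_finset_quadtree_triples (n : ℕ) :
    ∃ F : Finset (ℕ × ℕ × ℕ),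
      {t : ℕ × ℕ × ℕ | t.1 < t.2.2 ∧ (t.2.2 + 1) * 2 ^ t.2.1 ≤ n} ⊆ F ∧
      3 * F.card ≤ 2 * n ^ 2 := by
  induction n using Nat.strong_induction_on with
  | _ n ih =>
    rcases Nat.eq_zero_or_pos n with rfl | hn
    · refine ⟨∅, ?_, by simp⟩
      rintro ⟨i, j, k⟩ ⟨-, h⟩
      have : 0 < (k + 1) * 2 ^ j := by positivity
      exact absurd h this.not_ge
    · obtain ⟨F, hF, hcard⟩ := ih (n / 2) (Nat.div_lt_self hn one_lt_two)
      let G : Finset (ℕ × ℕ × ℕ) :=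
        ((Finset.range n).sigma fun k => Finset.range k).image fun p => (p.2, 0, p.1)
      let H : Finset (ℕ × ℕ × ℕ) := F.image fun t => (t.1, t.2.1 + 1, t.2.2)
      refine ⟨G ∪ H, ?_, ?_⟩
      · rintro ⟨i, j, k⟩ ⟨hik, h⟩
        rw [Finset.mem_coe, Finset.mem_union]
        cases j with
        | zero =>
          refine Or.inl (Finset.mem_image.2 ⟨⟨k, i⟩, ?_, rfl⟩)
          simp only [Finset.mem_sigma, Finset.mem_range]
          exact ⟨by simpa using h, hik⟩
        | succ j =>
          refine Or.inr (Finset.mem_image.2 ⟨(i, j, k), hF ⟨hik, ?_⟩, rfl⟩)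
          rw [Nat.le_div_iff_mul_le two_pos, mul_assoc, ← pow_succ]
          exact h
      · have hG : G.card * 2 ≤ n * (n - 1) := by
          rw [← Finset.sum_range_id_mul_two]
          refine Nat.mul_le_mul_right 2 (Finset.card_image_le.trans ?_)
          simp
        have hH : H.card ≤ F.card := Finset.card_image_le
        have hU : (G ∪ H).card ≤ G.card + H.card := Finset.card_union_le G H
        have hG' : n * (n - 1) ≤ n * n := Nat.mul_le_mul_left n (Nat.sub_le n 1)
        have hdiv : 2 * (n / 2) ≤ n := Nat.mul_div_le n 2
        nlinarith [Nat.mul_le_mul hdiv hdiv]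

/-- The number of values `D(i,j,k)` stored by the quadtree data structure is at most `2n²/3`:
the set of triples `(i,j,k)` with `i < k` and `(k+1)·2^j ≤ n` is finite of cardinality `D`
with `3·D ≤ 2·n²`. -/
theorem quadtree_distances_count (n : ℕ) (hn : 0 < n) :
    {t : ℕ × ℕ × ℕ | t.1 < t.2.2 ∧ (t.2.2 + 1) * 2 ^ t.2.1 ≤ n}.Finite ∧
    3 * {t : ℕ × ℕ × ℕ | t.1 < t.2.2 ∧ (t.2.2 + 1) * 2 ^ t.2.1 ≤ n}.ncard ≤ 2 * n ^ 2 := by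
  obtain ⟨F, hF, hcard⟩ := exists_finset_quadtree_triples n
  refine ⟨F.finite_toSet.subset hF, le_trans (Nat.mul_le_mul_left 3 ?_) hcard⟩
  rw [← Set.ncard_coe_finset F]
  exact Set.ncard_le_ncard hF F.finite_toSet
end

section
/- Fix natural numbers n ≥ 1 and m with m < n. The set of triples (i,j,k) of natural numbers satisfying i < k, (k+1)·2^j ≤ n, and either i·2^j ≤ m < (i+1)·2^j or k·2^j ≤ m < (k+1)·2^j, is finite and has cardinality at most 2n − 1. (This bounds the number of values D(i,j,k) that can change when the single object x_m is inserted, since D(i,j,k) changes only if S(i,j) or S(k,j) contains the inserted object.) -/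
/-- Each insertion of an object `x_m` causes at most `2n - 1` values `D(i,j,k)` to change:
the set of triples `(i,j,k)` with `i < k`, `(k+1)·2^j ≤ n`, and `x_m ∈ S(i,j)` or
`x_m ∈ S(k,j)`, is finite of cardinality at most `2n - 1`. -/
theorem quadtree_changed_distances_count (n m : ℕ) (hn : 1 ≤ n) (hm : m < n) :
    {t : ℕ × ℕ × ℕ | t.1 < t.2.2 ∧ (t.2.2 + 1) * 2 ^ t.2.1 ≤ n ∧
        ((t.1 * 2 ^ t.2.1 ≤ m ∧ m < (t.1 + 1) * 2 ^ t.2.1) ∨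
         (t.2.2 * 2 ^ t.2.1 ≤ m ∧ m < (t.2.2 + 1) * 2 ^ t.2.1))}.Finite ∧
    {t : ℕ × ℕ × ℕ | t.1 < t.2.2 ∧ (t.2.2 + 1) * 2 ^ t.2.1 ≤ n ∧
        ((t.1 * 2 ^ t.2.1 ≤ m ∧ m < (t.1 + 1) * 2 ^ t.2.1) ∨
         (t.2.2 * 2 ^ t.2.1 ≤ m ∧ m < (t.2.2 + 1) * 2 ^ t.2.1))}.ncard ≤ 2 * n - 1 := by
  set T : Finset (Σ _ : ℕ, ℕ) :=
    ((Finset.range n).sigma fun j => Finset.range (n / 2 ^ j)).erase ⟨0, m⟩ with hT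
  have hcard : T.card ≤ 2 * n - 1 := by
    rw [hT, Finset.card_erase_of_mem (by simp; omega), Finset.card_sigma]
    have h := Nat.geom_sum_le le_rfl n n
    simp only [Finset.card_range]
    omega
  set g : (Σ _ : ℕ, ℕ) → ℕ × ℕ × ℕ := fun p =>
    (min p.2 (m / 2 ^ p.1), p.1, max p.2 (m / 2 ^ p.1)) with hg
  have hsub : {t : ℕ × ℕ × ℕ | t.1 < t.2.2 ∧ (t.2.2 + 1) * 2 ^ t.2.1 ≤ n ∧
        ((t.1 * 2 ^ t.2.1 ≤ m ∧ m < (t.1 + 1) * 2 ^ t.2.1) ∨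
         (t.2.2 * 2 ^ t.2.1 ≤ m ∧ m < (t.2.2 + 1) * 2 ^ t.2.1))} ⊆ ↑(T.image g) := by
    rintro ⟨i, j, k⟩ ⟨hik, hkn, hmem⟩
    dsimp only at hik hkn hmem
    have hpos : 0 < 2 ^ j := by positivity
    have hk : k + 1 ≤ n / 2 ^ j := (Nat.le_div_iff_mul_le hpos).2 hkn
    have hj : j < n := by
      have h : 2 ^ j ≤ (k + 1) * 2 ^ j := Nat.le_mul_of_pos_left _ k.succ_pos
      exact Nat.lt_two_pow_self.trans_le (h.trans hkn)
    rw [Finset.coe_image]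
    rcases hmem with h | h
    · have hq : m / 2 ^ j = i := Nat.div_eq_of_lt_le h.1 h.2
      refine ⟨⟨j, k⟩, ?_, by simp [hg, hq, hik.le]⟩
      simp only [hT, Finset.mem_coe, Finset.mem_erase, Finset.mem_sigma, Finset.mem_range]
      refine ⟨?_, hj, hk⟩
      rintro ⟨⟩
      simp at hq
      omega
    · have hq : m / 2 ^ j = k := Nat.div_eq_of_lt_le h.1 h.2
      refine ⟨⟨j, i⟩, ?_, by simp [hg, hq, hik.le]⟩
      simp only [hT, Finset.mem_coe, Finset.mem_erase, Finset.mem_sigma, Finset.mem_range]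
      refine ⟨?_, hj, by omega⟩
      rintro ⟨⟩
      simp at hq
      omega
  refine ⟨(T.image g).finite_toSet.subset hsub, ?_⟩
  have hle := Set.ncard_le_ncard hsub (T.image g).finite_toSet
  rw [Set.ncard_coe_finset] at hle
  exact hle.trans (Finset.card_image_le.trans hcard)
end

section
/- Let n ≥ 2 and let d : Fin n → Fin n → ℝ be symmetric (d(a,b) = d(b,a) for all a, b). Suppose the indices 0, 1, …, n−1 form a nearest-neighbor path: for every k with k+1 < n and every m with k < m < n, d(k, k+1) ≤ d(k, m). Then some edge of the path realizes the closest-pair distance: there exists k with k+1 < n such that d(k, k+1) ≤ d(a, b) for all a, b with a ≠ b. -/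
/-- If the indices `0, 1, …, n-1` form a nearest-neighbor path for a symmetric distance
function `d`, then some edge of the path realizes the closest-pair distance. -/
theorem nearest_neighbor_path_contains_closest_pair
    (n : ℕ) (hn : 2 ≤ n) (d : Fin n → Fin n → ℝ)
    (hsym : ∀ a b : Fin n, d a b = d b a)
    (hpath : ∀ (k : ℕ) (hk : k + 1 < n) (m : Fin n), k < (m : ℕ) →
      d ⟨k, by omega⟩ ⟨k + 1, hk⟩ ≤ d ⟨k, by omega⟩ m) :
    ∃ (k : ℕ) (hk : k + 1 < n), ∀ a b : Fin n, a ≠ b →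
      d ⟨k, by omega⟩ ⟨k + 1, hk⟩ ≤ d a b := by
  have : Nonempty (Fin (n - 1)) := ⟨⟨0, by omega⟩⟩
  obtain ⟨k, hk⟩ := Finite.exists_min fun i : Fin (n - 1) ↦
    d ⟨i, by omega⟩ ⟨i + 1, by omega⟩
  refine ⟨k, by omega, fun a b hab ↦ ?_⟩
  wlog h : a < b generalizing a b
  · rw [hsym a b]
    exact this b a hab.symm (hab.lt_or_gt.resolve_left h)
  · exact (hk ⟨a, by omega⟩).trans (hpath a (by omega) b h)
end

section
/- Let α be a finite set of n points, let A be a subset of α, and let d : α → α → ℝ be symmetric. Let x_0, x_1, …, x_{m−1} (m ≥ 1) be a sequence of distinct points of α such that: (i) for every k with k+1 < m, if x_k ∈ A then d(x_k, x_{k+1}) ≤ d(x_k, y) for every point y not among x_0, …, x_k; (ii) for every k with k+1 < m, if x_k ∉ A then d(x_k, x_{k+1}) ≤ d(x_k, y) for every y ∈ A not among x_0, …, x_k; and (iii) the path is maximal, i.e., if x_{m−1} ∈ A then {x_0, …, x_{m−1}} = α, and if x_{m−1} ∉ A then A ⊆ {x_0, …, x_{m−1}}. Then for every s ∈ A and every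 t ≠ s in α, there exists k with k+1 < m such that d(x_k, x_{k+1}) ≤ d(s, t). -/
/-- Key invariant of the conga line path-creation step.  Given a maximal path
`x_0, …, x_{m-1}` of distinct points in a finite set `α`, alternating between nearest
neighbors in all of `α` (when the current vertex lies in the new subset `A`) and nearest
neighbors in `A` (otherwise), every pair `(s, t)` with `s ∈ A`, `t ≠ s` is covered by
some path edge of no greater length. -/
theorem conga_path_covers_pairs
    {α : Type*} [Fintype α] (n : ℕ) (hcard : Fintype.card α = n)
    (A : Set α) (d : α → α → ℝ) (hsym : ∀ a b : α, d a b = d b a)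
    (m : ℕ) (hm : 1 ≤ m) (x : ℕ → α)
    (hinj : ∀ i j, i < m → j < m → x i = x j → i = j)
    (hA : ∀ k, k + 1 < m → x k ∈ A →
      ∀ y : α, (∀ l, l ≤ k → x l ≠ y) → d (x k) (x (k + 1)) ≤ d (x k) y)
    (hnA : ∀ k, k + 1 < m → x k ∉ A →
      ∀ y ∈ A, (∀ l, l ≤ k → x l ≠ y) → d (x k) (x (k + 1)) ≤ d (x k) y)
    (hmaxA : x (m - 1) ∈ A → ∀ z : α, ∃ l, l < m ∧ x l = z)
    (hmaxnA : x (m - 1) ∉ A → ∀ z ∈ A, ∃ l, l < m ∧ x l = z) :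
    ∀ s ∈ A, ∀ t : α, t ≠ s → ∃ k, k + 1 < m ∧ d (x k) (x (k + 1)) ≤ d s t := by
  intro s hs t hts
  obtain ⟨i, him, rfl⟩ : ∃ l, l < m ∧ x l = s := by
    by_cases h : x (m - 1) ∈ A
    · exact hmaxA h s
    · exact hmaxnA h s hs
  by_cases ht : ∃ j, j < i ∧ x j = t
  · obtain ⟨j, hji, rfl⟩ := ht
    have hne : ∀ l, l ≤ j → x l ≠ x i := fun l hl h => by
      have := hinj l i (by omega) him h
      omega
    refine ⟨j, by omega, ?_⟩
    rw [hsym (x i) (x j)]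
    by_cases hj : x j ∈ A
    · exact hA j (by omega) hj _ hne
    · exact hnA j (by omega) hj _ hs hne
  · have hne : ∀ l, l ≤ i → x l ≠ t := fun l hl h => by
      rcases hl.eq_or_lt with rfl | hlt
      · exact hts h.symm
      · exact ht ⟨l, hlt, h⟩
    have hi : i + 1 < m := by
      by_contra hlast
      obtain rfl : i = m - 1 := by omega
      obtain ⟨l, hl, hlt⟩ := hmaxA hs t
      exact hne l (by omega) hlt
    exact ⟨i, hi, hA i hi hs t hne⟩
end
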